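/- Let c_1, c_2, c_3, c_4 be the Jordan–Wigner Majorana operators on (ℂ²)^{⊗2} (n = 2 qubits), let S = −c_1 c_2 c_3 c_4, X̄ = i c_1 c_2, Z̄ = i c_2 c_3, Ȳ = i X̄ Z̄. Let (b^x, b^y, b^z) ∈ ℝ³ be a unit vector and define the C4-encoded state ρ̄ = (1/4)(I + S)(I + b^x X̄ + b^y Ȳ + b^z Z̄). Then ρ̄ is a density matrix and its covariance matrix M_{p,q} = Tr(i c_p c_q ρ̄) (p ≠ q), M_{p,p} = 0, equals the antisymmetric matrix with upper-triangular entries M_{12} = b^x, M_{13} = −b^y, M_{14} = b^z, M_{23} = b^z, M_{24} = b^y, M_{34} = b^x. -/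

import Mathlib

open scoped Matrix ComplexOrder

/-- The Pauli X matrix. -/
noncomputable def pauliX : Matrix (Fin 2) (Fin 2) ℂ := !![0, 1; 1, 0]

/-- The Pauli Y matrix. -/
noncomputable def pauliY : Matrix (Fin 2) (Fin 2) ℂ := !![0, -Complex.I; Complex.I, 0]

/-- The Pauli Z matrix. -/
noncomputable def pauliZ : Matrix (Fin 2) (Fin 2) ℂ := !![1, 0; 0, -1]

/-- The `n`-fold tensor (Kronecker) product of single-qubit matrices. -/
noncomputable def tensorProd (n : ℕ) (A : Fin n → Matrix (Fin 2) (Fin 2) ℂ) :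
    Matrix (Fin n → Fin 2) (Fin n → Fin 2) ℂ :=
  fun x y => ∏ j : Fin n, A j (x j) (y j)

/-- The Jordan–Wigner Majorana operators (0-indexed):
`c_{2j} = Z^{⊗j} ⊗ Y ⊗ I^{⊗(n-j-1)}`, `c_{2j+1} = Z^{⊗j} ⊗ X ⊗ I^{⊗(n-j-1)}`. -/
noncomputable def jw (n : ℕ) (p : Fin (2 * n)) :
    Matrix (Fin n → Fin 2) (Fin n → Fin 2) ℂ :=
  tensorProd n (fun j =>
    if (j : ℕ) < (p : ℕ) / 2 then pauliZ
    else if (j : ℕ) = (p : ℕ) / 2 then (if (p : ℕ) % 2 = 0 then pauliY else pauliX)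
    else 1)

/-- The four Majorana modes of the C4-code (two qubits, `2n = 4` modes). -/
noncomputable def c4 (p : Fin 4) : Matrix (Fin 2 → Fin 2) (Fin 2 → Fin 2) ℂ :=
  jw 2 ⟨(p : ℕ), by omega⟩

/-- Covariance matrix entry `M_{p,q} = Tr(i c_p c_q ρ)` for `p ≠ q` (and `0` on the
diagonal). -/
noncomputable def covC4 (ρ : Matrix (Fin 2 → Fin 2) (Fin 2 → Fin 2) ℂ) (p q : Fin 4) : ℂ :=
  if p = q then 0 else (Complex.I • (c4 p * c4 q) * ρ).trace

/-- Two-qubit tensor product. -/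
noncomputable def T2 (A B : Matrix (Fin 2) (Fin 2) ℂ) :
    Matrix (Fin 2 → Fin 2) (Fin 2 → Fin 2) ℂ := tensorProd 2 ![A, B]

lemma T2_apply (A B : Matrix (Fin 2) (Fin 2) ℂ) (x y : Fin 2 → Fin 2) :
    T2 A B x y = A (x 0) (y 0) * B (x 1) (y 1) := by
  simp [T2, tensorProd, Fin.prod_univ_two]

lemma sum_fin2 (f : (Fin 2 → Fin 2) → ℂ) :
    ∑ x, f x = ∑ a : Fin 2, ∑ b : Fin 2, f ![a, b] := by
  rw [← (finTwoArrowEquiv (Fin 2)).symm.sum_comp, Fintype.sum_prod_type]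
  rfl

lemma T2_mul (A B C D : Matrix (Fin 2) (Fin 2) ℂ) :
    T2 A B * T2 C D = T2 (A * C) (B * D) := by
  ext x y
  simp only [Matrix.mul_apply, sum_fin2, T2_apply, Fin.sum_univ_two, Matrix.cons_val_zero,
    Matrix.cons_val_one]
  ring

lemma T2_trace (A B : Matrix (Fin 2) (Fin 2) ℂ) :
    (T2 A B).trace = A.trace * B.trace := by
  simp only [Matrix.trace, Matrix.diag, sum_fin2, T2_apply, Fin.sum_univ_two,
    Matrix.cons_val_zero, Matrix.cons_val_one]
  ring

lemma T2_conj (A B : Matrix (Fin 2) (Fin 2) ℂ) : (T2 A B)ᴴ = T2 Aᴴ Bᴴ := by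
  ext x y
  simp [Matrix.conjTranspose_apply, T2_apply]

lemma T2_one : T2 1 1 = 1 := by
  ext x y
  simp only [T2_apply, Matrix.one_apply, funext_iff, Fin.forall_fin_two]
  split_ifs <;> simp_all

lemma T2_smul_left (a : ℂ) (A B : Matrix (Fin 2) (Fin 2) ℂ) : T2 (a • A) B = a • T2 A B := by
  ext x y
  simp [T2_apply, mul_assoc]

lemma T2_smul_right (a : ℂ) (A B : Matrix (Fin 2) (Fin 2) ℂ) : T2 A (a • B) = a • T2 A B := by
  ext x y
  simp [T2_apply, mul_left_comm]

lemma pXX : pauliX * pauliX = 1 := by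
  ext i j; fin_cases i <;> fin_cases j <;> simp [pauliX]
lemma pYY : pauliY * pauliY = 1 := by
  ext i j; fin_cases i <;> fin_cases j <;> simp [pauliY]
lemma pZZ : pauliZ * pauliZ = 1 := by
  ext i j; fin_cases i <;> fin_cases j <;> simp [pauliZ]
lemma pXY : pauliX * pauliY = Complex.I • pauliZ := by
  ext i j; fin_cases i <;> fin_cases j <;> simp [pauliX, pauliY, pauliZ]
lemma pYX : pauliY * pauliX = (-Complex.I) • pauliZ := by
  ext i j; fin_cases i <;> fin_cases j <;> simp [pauliX, pauliY, pauliZ]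
lemma pYZ : pauliY * pauliZ = Complex.I • pauliX := by
  ext i j; fin_cases i <;> fin_cases j <;> simp [pauliX, pauliY, pauliZ]
lemma pZY : pauliZ * pauliY = (-Complex.I) • pauliX := by
  ext i j; fin_cases i <;> fin_cases j <;> simp [pauliX, pauliY, pauliZ]
lemma pZX : pauliZ * pauliX = Complex.I • pauliY := by
  ext i j; fin_cases i <;> fin_cases j <;> simp [pauliX, pauliY, pauliZ]
lemma pXZ : pauliX * pauliZ = (-Complex.I) • pauliY := by
  ext i j; fin_cases i <;> fin_cases j <;> simp [pauliX, pauliY, pauliZ]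
lemma tX : pauliX.trace = 0 := by simp [pauliX, Matrix.trace_fin_two]
lemma tY : pauliY.trace = 0 := by simp [pauliY, Matrix.trace_fin_two]
lemma tZ : pauliZ.trace = 0 := by simp [pauliZ, Matrix.trace_fin_two]
lemma hermX : pauliXᴴ = pauliX := by
  ext i j; fin_cases i <;> fin_cases j <;> simp [pauliX]
lemma hermY : pauliYᴴ = pauliY := by
  ext i j; fin_cases i <;> fin_cases j <;> simp [pauliY]
lemma hermZ : pauliZᴴ = pauliZ := by
  ext i j; fin_cases i <;> fin_cases j <;> simp [pauliZ]

lemma c4_0 : c4 0 = T2 pauliY 1 := by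
  unfold c4 jw T2; congr 1; funext j; fin_cases j <;> simp
lemma c4_1 : c4 1 = T2 pauliX 1 := by
  unfold c4 jw T2; congr 1; funext j; fin_cases j <;> simp
lemma c4_2 : c4 2 = T2 pauliZ pauliY := by
  unfold c4 jw T2; congr 1; funext j; fin_cases j <;> simp
lemma c4_3 : c4 3 = T2 pauliZ pauliX := by
  unfold c4 jw T2; congr 1; funext j; fin_cases j <;> simp

lemma c4_anti (p q : Fin 4) (h : p ≠ q) : c4 p * c4 q = -(c4 q * c4 p) := by
  fin_cases p <;> fin_cases q <;> first | exact absurd rfl h | skip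
  all_goals
    simp [c4_0, c4_1, c4_2, c4_3, T2_mul, pXX, pYY, pZZ, pXY, pYX, pYZ, pZY, pZX, pXZ,
      T2_smul_left, T2_smul_right, -neg_smul]
  all_goals try module

/-- the C4-encoded state `ρ̄ = (1/4)(I + S)(I + bˣ X̄ + bʸ Ȳ + bᶻ Z̄)` of a qubit
with unit Bloch vector `(bˣ, bʸ, bᶻ)` is a density matrix, and its covariance matrix is the
antisymmetric matrix with upper-triangular entries
`M₁₂ = bˣ, M₁₃ = −bʸ, M₁₄ = bᶻ, M₂₃ = bᶻ, M₂₄ = bʸ, M₃₄ = bˣ`. -/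
theorem c4_encoded_state_covariance (bx by' bz : ℝ)
    (hunit : bx ^ 2 + by' ^ 2 + bz ^ 2 = 1)
    (S Xb Zb Yb ρ : Matrix (Fin 2 → Fin 2) (Fin 2 → Fin 2) ℂ)
    (hS : S = -(c4 0 * c4 1 * c4 2 * c4 3))
    (hX : Xb = Complex.I • (c4 0 * c4 1))
    (hZ : Zb = Complex.I • (c4 1 * c4 2))
    (hY : Yb = Complex.I • (Xb * Zb))
    (hρ : ρ = (1 / 4 : ℂ) •
      ((1 + S) * (1 + (bx : ℂ) • Xb + (by' : ℂ) • Yb + (bz : ℂ) • Zb))) :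
    ρᴴ = ρ ∧ ρ.PosSemidef ∧ ρ.trace = 1 ∧
    (∀ p q : Fin 4, covC4 ρ p q = -covC4 ρ q p) ∧
    covC4 ρ 0 1 = (bx : ℂ) ∧ covC4 ρ 0 2 = (-by' : ℂ) ∧ covC4 ρ 0 3 = (bz : ℂ) ∧
    covC4 ρ 1 2 = (bz : ℂ) ∧ covC4 ρ 1 3 = (by' : ℂ) ∧ covC4 ρ 2 3 = (bx : ℂ) := by
  have hS' : S = T2 pauliZ pauliZ := by
    rw [hS, c4_0, c4_1, c4_2, c4_3]
    simp only [T2_mul, mul_one, one_mul, pYX, pZZ, pXX, pYY, smul_mul_assoc, T2_smul_left,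
      T2_smul_right, smul_smul, ← neg_smul]
    simp
  have hX' : Xb = T2 pauliZ 1 := by
    rw [hX, c4_0, c4_1]
    simp only [T2_mul, mul_one, pYX, T2_smul_left, smul_smul]
    simp
  have hZ' : Zb = T2 pauliY pauliY := by
    rw [hZ, c4_1, c4_2]
    simp only [T2_mul, one_mul, pXZ, T2_smul_left, smul_smul]
    simp
  have hY' : Yb = T2 pauliX pauliY := by
    rw [hY, hX', hZ']
    simp only [T2_mul, one_mul, pZY, T2_smul_left, smul_smul]
    simp
  have hform : ρ = (1 / 4 : ℂ) • (T2 1 1 + T2 pauliZ pauliZ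
      + (bx : ℂ) • (T2 pauliZ 1 + T2 1 pauliZ)
      + (by' : ℂ) • (T2 pauliX pauliY + T2 pauliY pauliX)
      + (bz : ℂ) • (T2 pauliY pauliY - T2 pauliX pauliX)) := by
    rw [hρ, hS', hX', hY', hZ', ← T2_one]
    simp only [mul_add, add_mul, T2_mul, mul_one, one_mul, mul_smul_comm, pZZ, pZX, pZY,
      T2_smul_left, T2_smul_right, smul_smul, mul_neg, neg_mul, Complex.I_mul_I]
    match_scalars <;> ring_nf <;> simp
  have hherm : ρᴴ = ρ := by
    rw [hform]
    simp [T2_conj, hermX, hermY, hermZ, add_comm]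
  have hc : (bz : ℂ) ^ 2 = 1 - (bx : ℂ) ^ 2 - (by' : ℂ) ^ 2 := by
    have : (bx : ℂ) ^ 2 + (by' : ℂ) ^ 2 + (bz : ℂ) ^ 2 = 1 := by exact_mod_cast hunit
    linear_combination this
  have hsq : ρ * ρ = ρ := by
    rw [hform]
    simp only [mul_add, add_mul, mul_sub, sub_mul, smul_add, smul_sub, T2_mul, mul_one, one_mul,
      mul_smul_comm, smul_mul_assoc, pXX, pYY, pZZ, pXY, pYX, pYZ, pZY, pZX, pXZ,
      T2_smul_left, T2_smul_right, smul_smul, mul_neg, neg_mul, Complex.I_mul_I]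
    match_scalars <;> ring_nf <;> simp only [Complex.I_sq, hc] <;> ring_nf
  have htr : ∀ p q, p ≠ q → covC4 ρ p q = (Complex.I • (c4 p * c4 q) * ρ).trace := by
    intro p q h
    simp [covC4, h]
  refine ⟨hherm, ?_, ?_, ?_, ?_, ?_, ?_, ?_, ?_, ?_⟩
  · have := Matrix.posSemidef_conjTranspose_mul_self ρ
    rwa [hherm, hsq] at this
  · rw [hform]
    simp [T2_trace, tX, tY, tZ]
    norm_num
  · intro p q
    by_cases h : p = q
    · simp [covC4, h]
    · rw [htr p q h, htr q p (Ne.symm h), c4_anti p q h]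
      simp
  all_goals
    rw [htr _ _ (by decide), hform]
    simp only [c4_0, c4_1, c4_2, c4_3, mul_add, add_mul, mul_sub, sub_mul, smul_add, smul_sub,
      T2_mul, mul_one, one_mul,
      mul_smul_comm, smul_mul_assoc, pXX, pYY, pZZ, pXY, pYX, pYZ, pZY, pZX, pXZ,
      T2_smul_left, T2_smul_right, smul_smul, mul_neg, neg_mul, Complex.I_mul_I,
      Matrix.trace_add, Matrix.trace_sub, Matrix.trace_smul, T2_trace, tX, tY, tZ,
      Matrix.trace_one, smul_eq_mul, mul_zero, zero_mul, Fintype.card_fin]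
    push_cast
    ring_nf
    try simp [Complex.I_sq]
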